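/- Let P₁ ≥ 2, X ≥ P₁², and suppose |ρ⁻(n)| ≤ 1_{gcd(n, P(z)) = 1} pointwise for n ∈ (X/(2P₁), 4X/P₁] where z = X^{2/11}. Assume the sieve bounds Σ_{X/(2P₁) ≤ n ≤ 4X/P₁} 1_{(n,P(z))=1}/n² ≪ P₁/(X log X) and, for each 0 < |k| ≤ 4X/(P₁T), Σ_{X/(2P₁) ≤ n ≤ 4X/P₁} 1_{(n(n+k),P(z))=1}/(n(n+k)) ≪ P₁/(X (log X)²) hold. Then for P(s) = Σ_{X/(2P₁) < n ≤ 4X/P₁} ρ⁻(n) n^{−s} and any T ≥ 1, ∫_{−T}^{T} |P(1+it)|² dt ≪ T P₁/(X log X) + 1/(log X)². -/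

import Mathlib

open Finset MeasureTheory

/-- Product of all primes below `y`. -/
noncomputable def primorialBelow (y : ℝ) : ℕ :=
  ∏ p ∈ (Finset.range (Nat.ceil y + 1)).filter (fun (p : ℕ) => p.Prime ∧ (p : ℝ) < y), p

open scoped FourierTransform

/-- The triangle function supported on `[-1, 1]`. -/
noncomputable def triangle (x : ℝ) : ℝ := max 0 (1 - |x|)

lemma continuous_triangle : Continuous triangle := by
  unfold triangle; fun_prop

lemma triangle_nonneg (x : ℝ) : 0 ≤ triangle x := le_max_left _ _

lemma triangle_le_one (x : ℝ) : triangle x ≤ 1 :=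
  max_le zero_le_one (by linarith [abs_nonneg x])

lemma triangle_eq_zero {x : ℝ} (hx : 1 ≤ |x|) : triangle x = 0 :=
  max_eq_left (by linarith)

lemma integrable_ofReal_triangle : Integrable (fun x => (triangle x : ℂ)) := by
  refine (Complex.continuous_ofReal.comp continuous_triangle).integrable_of_hasCompactSupport ?_
  refine HasCompactSupport.intro (isCompact_Icc (a := (-1 : ℝ)) (b := 1)) fun x hx => ?_
  have : 1 ≤ |x| := by
    by_contra! h
    exact hx ⟨(abs_lt.1 h).1.le, (abs_lt.1 h).2.le⟩
  simp [triangle_eq_zero this]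

lemma integral_one_sub_mul_cexp {c : ℂ} (hc : c ≠ 0) :
    ∫ x in (0 : ℝ)..1, ((1 - x : ℝ) : ℂ) * Complex.exp (c * x) =
      (Complex.exp c - 1 - c) / c ^ 2 := by
  have hderiv : ∀ x ∈ Set.uIcc (0 : ℝ) 1,
      HasDerivAt (fun x : ℝ => ((1 - x) / c + 1 / c ^ 2 : ℂ) * Complex.exp (c * x))
        (((1 - x : ℝ) : ℂ) * Complex.exp (c * x)) x := by
    intro x _
    have h1 : HasDerivAt (fun z : ℂ => ((1 - z) / c + 1 / c ^ 2 : ℂ) * Complex.exp (c * z))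
        ((-1 / c) * Complex.exp (c * x) +
          ((1 - x) / c + 1 / c ^ 2 : ℂ) * (Complex.exp (c * x) * (c * 1))) (x : ℂ) :=
      ((((hasDerivAt_id (x : ℂ)).const_sub 1).div_const c).add_const _).mul
        (((hasDerivAt_id (x : ℂ)).const_mul c).cexp)
    convert! h1.comp_ofReal using 1
    push_cast
    field_simp
    ring
  rw [intervalIntegral.integral_eq_sub_of_hasDerivAt hderiv
    (Continuous.intervalIntegrable (by fun_prop) _ _)]
  push_cast
  simp
  field_simp
  ring

lemma fourier_triangle (ξ : ℝ) :
    𝓕 (fun x => (triangle x : ℂ)) ξ = ((Real.sinc (Real.pi * ξ) ^ 2 : ℝ) : ℂ) := by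
  rw [Real.fourier_real_eq_integral_exp_smul]
  have hsupp : ∫ x : ℝ, Complex.exp (((-2 * Real.pi * x * ξ : ℝ) : ℂ) * Complex.I) •
      (triangle x : ℂ) = ∫ x in (-1 : ℝ)..1,
        Complex.exp (((-2 * Real.pi * x * ξ : ℝ) : ℂ) * Complex.I) • (triangle x : ℂ) := by
    rw [intervalIntegral.integral_of_le (by norm_num),
      setIntegral_eq_integral_of_forall_compl_eq_zero]
    intro x hx
    have : 1 ≤ |x| := by
      by_contra! h
      exact hx ⟨(abs_lt.1 h).1, (abs_lt.1 h).2.le⟩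
    simp [triangle_eq_zero this]
  have hcont : Continuous fun x : ℝ =>
      Complex.exp (((-2 * Real.pi * x * ξ : ℝ) : ℂ) * Complex.I) • (triangle x : ℂ) := by
    have := continuous_triangle
    fun_prop
  rw [hsupp, ← intervalIntegral.integral_add_adjacent_intervals
    (hcont.intervalIntegrable (-1) 0) (hcont.intervalIntegrable 0 1)]
  set c : ℂ := 2 * Real.pi * ξ * Complex.I with hcdef
  have hpos : ∫ x in (0 : ℝ)..1,
      Complex.exp (((-2 * Real.pi * x * ξ : ℝ) : ℂ) * Complex.I) • (triangle x : ℂ) =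
      ∫ x in (0 : ℝ)..1, ((1 - x : ℝ) : ℂ) * Complex.exp (-c * x) := by
    refine intervalIntegral.integral_congr fun x hx => ?_
    rw [Set.uIcc_of_le zero_le_one] at hx
    have : triangle x = 1 - x := by
      rw [triangle, abs_of_nonneg hx.1, max_eq_right (by linarith [hx.2])]
    simp only [this, smul_eq_mul, hcdef]
    rw [mul_comm]
    congr 2
    push_cast
    ring
  have hneg : ∫ x in (-1 : ℝ)..0,
      Complex.exp (((-2 * Real.pi * x * ξ : ℝ) : ℂ) * Complex.I) • (triangle x : ℂ) =
      ∫ x in (0 : ℝ)..1, ((1 - x : ℝ) : ℂ) * Complex.exp (c * x) := by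
    have h := intervalIntegral.integral_comp_neg (a := 0) (b := 1) (fun x : ℝ =>
      Complex.exp (((-2 * Real.pi * x * ξ : ℝ) : ℂ) * Complex.I) • (triangle x : ℂ))
    rw [neg_zero] at h
    rw [← h]
    refine intervalIntegral.integral_congr fun x hx => ?_
    rw [Set.uIcc_of_le zero_le_one] at hx
    have : triangle (-x) = 1 - x := by
      rw [triangle, abs_neg, abs_of_nonneg hx.1, max_eq_right (by linarith [hx.2])]
    simp only [this, smul_eq_mul, hcdef]
    rw [mul_comm]
    congr 2
    push_cast
    ring
  rw [hpos, hneg]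
  rcases eq_or_ne ξ 0 with rfl | hξ
  · have hc0 : c = 0 := by simp [hcdef]
    have : ∫ x in (0 : ℝ)..1, ((1 - x : ℝ) : ℂ) = 1 / 2 := by
      rw [intervalIntegral.integral_ofReal, intervalIntegral.integral_sub (by simp) (by simp)]
      norm_num
    simp only [hc0, neg_zero, zero_mul, Complex.exp_zero, mul_one, this]
    norm_num
  · have hc : c ≠ 0 := by simp [hcdef, hξ, Real.pi_ne_zero]
    rw [integral_one_sub_mul_cexp hc, integral_one_sub_mul_cexp (neg_ne_zero.2 hc),
      Real.sinc_of_ne_zero (mul_ne_zero Real.pi_ne_zero hξ)]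
    have hcos : Complex.exp c + Complex.exp (-c) = 2 - 4 * (Complex.sin (Real.pi * ξ)) ^ 2 := by
      have h1 := Complex.two_cos (2 * (Real.pi * ξ : ℂ))
      have h2 := Complex.cos_two_mul (Real.pi * ξ : ℂ)
      have h3 := Complex.sin_sq_add_cos_sq (Real.pi * ξ : ℂ)
      have e1 : (2 * (Real.pi * ξ : ℂ)) * Complex.I = c := by rw [hcdef]; ring
      have e2 : -(2 * (Real.pi * ξ : ℂ)) * Complex.I = -c := by rw [hcdef]; ring
      rw [e1, e2] at h1
      rw [← h1, h2]
      linear_combination 4 * h3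
    have hsq : c ^ 2 = -4 * (Real.pi * ξ) ^ 2 := by
      rw [hcdef]; linear_combination (2 * Real.pi * ξ : ℂ) ^ 2 * Complex.I_sq
    have hpi : (Real.pi * ξ : ℂ) ≠ 0 := by
      exact_mod_cast mul_ne_zero Real.pi_ne_zero hξ
    rw [neg_sq, ← add_div, hsq]
    push_cast
    rw [div_pow, div_eq_div_iff (by simpa using hpi) (pow_ne_zero 2 hpi)]
    linear_combination ((Real.pi * ξ : ℂ) ^ 2) * hcos

lemma integrable_sinc_sq : Integrable (fun x => Real.sinc x ^ 2) := by
  refine (integrable_inv_one_add_sq.const_mul 2).mono'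
    (Real.continuous_sinc.pow 2).aestronglyMeasurable (.of_forall fun x => ?_)
  rw [Real.norm_eq_abs, abs_of_nonneg (sq_nonneg _), ← div_eq_mul_inv,
    le_div_iff₀ (by positivity)]
  have h1 : Real.sinc x ^ 2 ≤ 1 := by
    rw [sq_le_one_iff_abs_le_one]; exact Real.abs_sinc_le_one x
  have h2 : Real.sinc x ^ 2 * x ^ 2 ≤ 1 := by
    rcases eq_or_ne x 0 with rfl | hx
    · simp
    · rw [Real.sinc_of_ne_zero hx, div_pow, div_mul_cancel₀ _ (pow_ne_zero 2 hx)]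
      exact Real.sin_sq_le_one x
  linarith

lemma integral_sinc_sq_mul_cexp (x : ℝ) :
    ∫ ξ : ℝ, Complex.exp ((2 * Real.pi * ξ * x : ℝ) * Complex.I) *
      ((Real.sinc (Real.pi * ξ) ^ 2 : ℝ) : ℂ) = triangle x := by
  have hF : 𝓕 (fun x => (triangle x : ℂ)) = fun ξ => ((Real.sinc (Real.pi * ξ) ^ 2 : ℝ) : ℂ) :=
    funext fourier_triangle
  have h := Continuous.fourierInv_fourier_eq
    (Complex.continuous_ofReal.comp continuous_triangle) integrable_ofReal_triangle
    (by
      have := (integrable_sinc_sq.comp_mul_left' Real.pi_ne_zero).ofReal (𝕜 := ℂ)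
      change Integrable (𝓕 (fun x => (triangle x : ℂ)))
      rw [hF]
      exact this)
  have h := congrFun h x
  change 𝓕⁻ (𝓕 (fun x => (triangle x : ℂ))) x = triangle x at h
  rw [hF, Real.fourierInv_eq'] at h
  rw [← h]
  refine integral_congr_ae (.of_forall fun ξ => ?_)
  simp only [smul_eq_mul, RCLike.inner_apply, conj_trivial]
  congr 4
  ring

/-- Fourier transform of a dilated Fejér kernel. -/
lemma integral_fejer {T : ℝ} (hT : 0 < T) (μ : ℝ) :
    ∫ t : ℝ, ((Real.sinc (t / (2 * T)) ^ 2 : ℝ) : ℂ) * Complex.exp ((t * μ : ℝ) * Complex.I) =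
      2 * Real.pi * T * triangle (T * μ) := by
  have hpi := Real.pi_pos
  have h := Measure.integral_comp_div (fun ξ : ℝ =>
    Complex.exp ((2 * Real.pi * ξ * (T * μ) : ℝ) * Complex.I) *
      ((Real.sinc (Real.pi * ξ) ^ 2 : ℝ) : ℂ)) (2 * Real.pi * T)
  rw [integral_sinc_sq_mul_cexp, abs_of_pos (by positivity)] at h
  rw [show (2 * Real.pi * T * triangle (T * μ) : ℂ) =
    (2 * Real.pi * T) • (triangle (T * μ) : ℂ) by simp, ← h]
  refine integral_congr_ae (.of_forall fun t => ?_)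
  simp only
  rw [mul_comm]
  congr 4 <;> field_simp

lemma quarter_le_sinc_sq {u : ℝ} (hu : |u| ≤ 1 / 2) : 1 / 4 ≤ Real.sinc u ^ 2 := by
  have hpi := Real.pi_gt_three
  have key : ∀ v : ℝ, 0 ≤ v → v ≤ 1 / 2 → 1 / 2 ≤ Real.sinc v := by
    intro v hv hv'
    rcases hv.eq_or_lt with rfl | hv0
    · norm_num
    · rw [Real.sinc_of_ne_zero hv0.ne', le_div_iff₀ hv0]
      have h1 := Real.mul_le_sin hv (by linarith)
      have h2 : (1 / 2 : ℝ) ≤ 2 / Real.pi := by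
        rw [div_le_div_iff₀ (by norm_num) (by linarith)]
        linarith [Real.pi_le_four]
      nlinarith
  have : 1 / 2 ≤ Real.sinc u := by
    rcases abs_cases u with ⟨h, _⟩ | ⟨h, _⟩
    · exact key u (by linarith) (by linarith)
    · rw [← Real.sinc_neg]; exact key (-u) (by linarith) (by linarith)
  nlinarith

/-- Mean value theorem for exponential sums, with only nearby frequencies interacting. -/
lemma integral_norm_sq_expSum_le {ι : Type*} (S : Finset ι) (a : ι → ℂ) (l : ι → ℝ)
    {T : ℝ} (hT : 0 < T) :
    ∫ t in (-T)..T, ‖∑ n ∈ S, a n * Complex.exp ((t * l n : ℝ) * Complex.I)‖ ^ 2 ≤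
      8 * Real.pi * T * ∑ m ∈ S, ∑ n ∈ S,
        if |l m - l n| < 1 / T then ‖a m‖ * ‖a n‖ else 0 := by
  set A : ℝ → ℂ := fun t => ∑ n ∈ S, a n * Complex.exp ((t * l n : ℝ) * Complex.I) with hA
  have hAc : Continuous A := by rw [hA]; fun_prop
  set w : ℝ → ℝ := fun t => Real.sinc (t / (2 * T)) ^ 2 with hw
  have hwi : Integrable w := integrable_sinc_sq.comp_div (by positivity)
  have hexp : ∀ t, ((w t * ‖A t‖ ^ 2 : ℝ) : ℂ) = ∑ m ∈ S, ∑ n ∈ S,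
      a m * (starRingEnd ℂ) (a n) *
        ((w t : ℂ) * Complex.exp ((t * (l m - l n) : ℝ) * Complex.I)) := by
    intro t
    have : ((‖A t‖ ^ 2 : ℝ) : ℂ) = A t * (starRingEnd ℂ) (A t) := by
      rw [Complex.mul_conj, Complex.normSq_eq_norm_sq]
    rw [Complex.ofReal_mul, this, hA]
    simp only [map_sum, map_mul, Finset.sum_mul_sum]
    rw [Finset.mul_sum]
    refine Finset.sum_congr rfl fun m _ => ?_
    rw [Finset.mul_sum]
    refine Finset.sum_congr rfl fun n _ => ?_
    have e : Complex.exp ((t * (l m - l n) : ℝ) * Complex.I) =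
        Complex.exp ((t * l m : ℝ) * Complex.I) *
          (starRingEnd ℂ) (Complex.exp ((t * l n : ℝ) * Complex.I)) := by
      rw [← Complex.exp_conj, ← Complex.exp_add]
      congr 1
      simp only [map_mul, Complex.conj_ofReal, Complex.conj_I]
      push_cast
      ring
    rw [e]
    ring
  have hint : ∀ m n, Integrable fun t : ℝ =>
      a m * (starRingEnd ℂ) (a n) *
        ((w t : ℂ) * Complex.exp ((t * (l m - l n) : ℝ) * Complex.I)) := by
    intro m n
    refine Integrable.const_mul ?_ _
    refine (hwi.ofReal (𝕜 := ℂ)).mul_bdd (c := 1) (Continuous.aestronglyMeasurable (by fun_prop))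
      (.of_forall fun t => ?_)
    rw [Complex.norm_exp_ofReal_mul_I]
  have hWA : Integrable fun t => w t * ‖A t‖ ^ 2 := by
    have h : Integrable fun t => ((w t * ‖A t‖ ^ 2 : ℝ) : ℂ) := by
      simp only [hexp]
      exact integrable_finsetSum _ fun m _ => integrable_finsetSum _ fun n _ => hint m n
    exact h.re
  have hval : ((∫ t, w t * ‖A t‖ ^ 2 : ℝ) : ℂ) = ∑ m ∈ S, ∑ n ∈ S,
      a m * (starRingEnd ℂ) (a n) * (2 * Real.pi * T * triangle (T * (l m - l n))) := by
    rw [← integral_complex_ofReal]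
    simp only [hexp]
    rw [integral_finsetSum _ fun m _ => integrable_finsetSum _ fun n _ => hint m n]
    refine Finset.sum_congr rfl fun m _ => ?_
    rw [integral_finsetSum _ fun n _ => hint m n]
    refine Finset.sum_congr rfl fun n _ => ?_
    rw [integral_const_mul, integral_fejer hT]
  have hle : ∫ t, w t * ‖A t‖ ^ 2 ≤ 2 * Real.pi * T * ∑ m ∈ S, ∑ n ∈ S,
      if |l m - l n| < 1 / T then ‖a m‖ * ‖a n‖ else 0 := by
    have h0 : ∫ t, w t * ‖A t‖ ^ 2 ≤ ‖((∫ t, w t * ‖A t‖ ^ 2 : ℝ) : ℂ)‖ := by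
      rw [Complex.norm_real]; exact le_abs_self _
    refine h0.trans ?_
    rw [hval, Finset.mul_sum]
    refine (norm_sum_le _ _).trans (Finset.sum_le_sum fun m _ => ?_)
    rw [Finset.mul_sum]
    refine (norm_sum_le _ _).trans (Finset.sum_le_sum fun n _ => ?_)
    have htri : triangle (T * (l m - l n)) ≤ if |l m - l n| < 1 / T then 1 else 0 := by
      split_ifs with h
      · exact triangle_le_one _
      · refine (triangle_eq_zero ?_).le
        rw [abs_mul, abs_of_pos hT]
        rw [not_lt, div_le_iff₀ hT] at h
        linarith
    have hnorm : ‖a m * (starRingEnd ℂ) (a n) *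
        (2 * Real.pi * T * triangle (T * (l m - l n)))‖ =
        2 * Real.pi * T * (‖a m‖ * ‖a n‖ * triangle (T * (l m - l n))) := by
      rw [norm_mul, norm_mul, RCLike.norm_conj]
      have : (2 * Real.pi * T * triangle (T * (l m - l n)) : ℂ) =
        ((2 * Real.pi * T * triangle (T * (l m - l n)) : ℝ) : ℂ) := by push_cast; ring
      rw [this, Complex.norm_real, Real.norm_eq_abs, abs_of_nonneg
        (mul_nonneg (by have := Real.pi_pos; positivity) (triangle_nonneg _))]
      ring
    rw [hnorm]
    refine mul_le_mul_of_nonneg_left ?_ (by have := Real.pi_pos; positivity)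
    refine (mul_le_mul_of_nonneg_left htri (by positivity)).trans_eq ?_
    split_ifs <;> simp
  have hfin : ∫ t in (-T)..T, ‖A t‖ ^ 2 ≤ 4 * ∫ t, w t * ‖A t‖ ^ 2 := by
    rw [← integral_const_mul, intervalIntegral.integral_of_le (by linarith)]
    refine le_trans (setIntegral_mono_on
      ((hAc.norm.pow 2).integrableOn_Icc.mono_set Set.Ioc_subset_Icc_self)
      (hWA.const_mul 4).integrableOn measurableSet_Ioc fun t ht => ?_)
      (setIntegral_le_integral (hWA.const_mul 4) (.of_forall fun t => by
        simp only [hw, Pi.zero_apply]; positivity))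
    have : 1 / 4 ≤ w t := quarter_le_sinc_sq (by
      rw [abs_div, abs_of_pos (by positivity : 0 < 2 * T), div_le_iff₀ (by positivity)]
      have := abs_le.2 ⟨ht.1.le, ht.2⟩
      linarith)
    nlinarith [sq_nonneg ‖A t‖]
  linarith

/-- Pairs of nearby integers, reorganised according to their difference. -/
lemma sum_near_diagonal_le (S : Finset ℕ) (hS : ∀ n ∈ S, 0 < n) {N T : ℝ} (hT : 0 < T)
    (hN : ∀ n ∈ S, (n : ℝ) ≤ N) (q : ℕ) (a : ℕ → ℝ) (ha0 : ∀ n ∈ S, 0 ≤ a n)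
    (ha : ∀ n ∈ S, a n ≤ (if Nat.Coprime n q then 1 else 0) / (n : ℝ)) :
    ∑ m ∈ S, ∑ n ∈ S, (if |Real.log m - Real.log n| < 1 / T then a m * a n else 0) ≤
      ∑ n ∈ S, (if Nat.Coprime n q then 1 else 0) / (n : ℝ) ^ 2 +
      2 * ∑ k ∈ Finset.Icc 1 ⌊N / T⌋₊, ∑ n ∈ S,
        (if Nat.Coprime (n * (n + k)) q then 1 else 0) / ((n : ℝ) * (n + k)) := by
  set g : ℕ → ℕ → ℝ := fun k n =>
    (if Nat.Coprime (n * (n + k)) q then 1 else 0) / ((n : ℝ) * (n + k)) with hg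
  have hg0 : ∀ k n, 0 ≤ g k n := by
    intro k n
    simp only [hg]
    split_ifs <;> positivity
  have hprod : ∀ n ∈ S, ∀ k, n + k ∈ S → a n * a (n + k) ≤ g k n := by
    intro n hn k hk
    refine (mul_le_mul (ha n hn) (ha _ hk) (ha0 _ hk) ((ha0 n hn).trans (ha n hn))).trans_eq ?_
    simp only [hg, Nat.coprime_mul_iff_left]
    rw [div_mul_div_comm]
    push_cast
    congr 1
    split_ifs <;> simp_all
  have hgap : ∀ n ∈ S, ∀ k, n + k ∈ S →
      Real.log ((n + k : ℕ) : ℝ) - Real.log n < 1 / T → k ≤ ⌊N / T⌋₊ := by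
    intro n hn k hk hlog
    have hn0 : (0 : ℝ) < n := by exact_mod_cast hS n hn
    have hk0 : (0 : ℝ) < ((n + k : ℕ) : ℝ) := by exact_mod_cast hS _ hk
    rw [← Real.log_div hk0.ne' hn0.ne'] at hlog
    have h1 := Real.one_sub_inv_le_log_of_pos (div_pos hk0 hn0)
    have h2 : 1 - (((n + k : ℕ) : ℝ) / n)⁻¹ = k / ((n + k : ℕ) : ℝ) := by
      rw [inv_div, eq_div_iff hk0.ne', sub_mul, div_mul_cancel₀ _ hk0.ne']
      push_cast; ring
    have h3 : (k : ℝ) / ((n + k : ℕ) : ℝ) < 1 / T := by linarith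
    rw [div_lt_div_iff₀ hk0 hT] at h3
    refine Nat.le_floor ?_
    rw [le_div_iff₀ hT]
    linarith [hN _ hk]
  have hpoint : ∀ m ∈ S, ∀ n ∈ S,
      (if |Real.log m - Real.log n| < 1 / T then a m * a n else 0) ≤
        (if m = n then (if Nat.Coprime n q then 1 else 0) / (n : ℝ) ^ 2 else 0) +
        ∑ k ∈ Finset.Icc 1 ⌊N / T⌋₊, (if m = n + k then g k n else 0) +
        ∑ k ∈ Finset.Icc 1 ⌊N / T⌋₊, (if n = m + k then g k m else 0) := by
    intro m hm n hn
    have hd0 : (0 : ℝ) ≤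
        if m = n then (if Nat.Coprime n q then 1 else 0) / (n : ℝ) ^ 2 else 0 := by
      split_ifs <;> positivity
    have hs0 : ∀ i j : ℕ, ∀ k ∈ Finset.Icc 1 ⌊N / T⌋₊, 0 ≤ if i = j + k then g k j else 0 := by
      intro i j k _
      split_ifs
      · exact hg0 _ _
      · exact le_rfl
    have h1 := Finset.sum_nonneg (hs0 m n)
    have h2 := Finset.sum_nonneg (hs0 n m)
    have hmem : ∀ i ∈ S, ∀ k, i + k ∈ S → k ≠ 0 →
        |Real.log ((i + k : ℕ) : ℝ) - Real.log i| < 1 / T →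
        a i * a (i + k) ≤
          ∑ j ∈ Finset.Icc 1 ⌊N / T⌋₊, (if i + k = i + j then g j i else 0) := by
      intro i hi k hik hk hlog
      refine (hprod i hi k hik).trans ?_
      have hkm : k ∈ Finset.Icc 1 ⌊N / T⌋₊ := Finset.mem_Icc.2
        ⟨Nat.one_le_iff_ne_zero.2 hk, hgap i hi k hik ((le_abs_self _).trans_lt hlog)⟩
      have := Finset.single_le_sum (hs0 (i + k) i) hkm
      simpa using this
    by_cases hlog : |Real.log m - Real.log n| < 1 / T
    swap
    · rw [if_neg hlog]
      linarith
    rw [if_pos hlog]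
    rcases lt_trichotomy m n with h | rfl | h
    · obtain ⟨k, rfl⟩ := Nat.exists_eq_add_of_lt h
      rw [add_assoc] at *
      have := hmem m hm (k + 1) hn (by omega) (by rwa [abs_sub_comm])
      linarith
    · have : a m * a m ≤ (if Nat.Coprime m q then 1 else 0) / (m : ℝ) ^ 2 := by
        refine (mul_le_mul (ha m hm) (ha m hm) (ha0 m hm)
          ((ha0 m hm).trans (ha m hm))).trans_eq ?_
        rw [div_mul_div_comm, ← sq (m : ℝ)]
        congr 1
        split_ifs <;> simp
      rw [if_pos rfl]
      linarith
    · obtain ⟨k, rfl⟩ := Nat.exists_eq_add_of_lt h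
      rw [add_assoc] at *
      have := hmem n hn (k + 1) hm (by omega) hlog
      linarith
  have hcollapse : ∑ n ∈ S, ∑ m ∈ S, ∑ k ∈ Finset.Icc 1 ⌊N / T⌋₊,
      (if m = n + k then g k n else 0) ≤ ∑ k ∈ Finset.Icc 1 ⌊N / T⌋₊, ∑ n ∈ S, g k n := by
    rw [Finset.sum_comm (s := Finset.Icc 1 ⌊N / T⌋₊)]
    refine Finset.sum_le_sum fun n _ => ?_
    rw [Finset.sum_comm]
    refine Finset.sum_le_sum fun k _ => ?_
    rw [Finset.sum_ite_eq']
    split_ifs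
    · exact le_rfl
    · exact hg0 _ _
  have hdiag : ∑ m ∈ S, ∑ n ∈ S,
      (if m = n then (if Nat.Coprime n q then 1 else 0) / (n : ℝ) ^ 2 else 0) =
      ∑ n ∈ S, (if Nat.Coprime n q then 1 else 0) / (n : ℝ) ^ 2 := by
    refine Finset.sum_congr rfl fun m hm => ?_
    rw [Finset.sum_ite_eq, if_pos hm]
  refine (Finset.sum_le_sum fun m hm => Finset.sum_le_sum fun n hn => hpoint m hm n hn).trans ?_
  simp only [Finset.sum_add_distrib]
  rw [hdiag]
  have hswap := hcollapse
  rw [Finset.sum_comm] at hswap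
  linarith

/-- Mean square bound for the Dirichlet polynomial `P(s) = ∑ ρ⁻(n) n^{-s}`, assuming
the pointwise majorization by rough numbers and the two sieve bounds. -/
theorem stmt18 (c₁ c₂ : ℝ) (hc₁ : 0 < c₁) (hc₂ : 0 < c₂) :
    ∃ C : ℝ, 0 < C ∧ ∀ (P1 X T : ℝ) (ρm : ℕ → ℝ),
      2 ≤ P1 → P1 ^ 2 ≤ X → 1 ≤ T →
      (∀ n ∈ (Finset.range (⌊4 * X / P1⌋₊ + 1)).filter
          (fun (n : ℕ) => X / (2 * P1) < (n : ℝ) ∧ (n : ℝ) ≤ 4 * X / P1),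
        |ρm n| ≤ (if Nat.Coprime n (primorialBelow (X ^ ((2 : ℝ)/11))) then 1 else 0)) →
      (∑ n ∈ (Finset.range (⌊4 * X / P1⌋₊ + 1)).filter
          (fun (n : ℕ) => X / (2 * P1) < (n : ℝ) ∧ (n : ℝ) ≤ 4 * X / P1),
          (if Nat.Coprime n (primorialBelow (X ^ ((2 : ℝ)/11))) then 1 else 0) / (n : ℝ) ^ 2) ≤
        c₁ * P1 / (X * Real.log X) →
      (∀ k : ℕ, 1 ≤ k → (k : ℝ) ≤ 4 * X / (P1 * T) →
        (∑ n ∈ (Finset.range (⌊4 * X / P1⌋₊ + 1)).filter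
            (fun (n : ℕ) => X / (2 * P1) < (n : ℝ) ∧ (n : ℝ) ≤ 4 * X / P1),
            (if Nat.Coprime (n * (n + k)) (primorialBelow (X ^ ((2 : ℝ)/11))) then 1 else 0) /
              ((n : ℝ) * (n + k))) ≤ c₂ * P1 / (X * Real.log X ^ 2)) →
      (∫ t in (-T)..T,
          ‖∑ n ∈ (Finset.range (⌊4 * X / P1⌋₊ + 1)).filter
              (fun (n : ℕ) => X / (2 * P1) < (n : ℝ) ∧ (n : ℝ) ≤ 4 * X / P1),
            (ρm n : ℂ) * (n : ℂ) ^ (-(1 : ℂ) - Complex.I * (t : ℂ))‖ ^ 2) ≤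
        C * (T * P1 / (X * Real.log X) + 1 / Real.log X ^ 2) := by
  refine ⟨8 * Real.pi * (c₁ + 8 * c₂), by have := Real.pi_pos; positivity, ?_⟩
  intro P1 X T ρm hP hX hT hρ h1 h2
  set S := (Finset.range (⌊4 * X / P1⌋₊ + 1)).filter
    (fun (n : ℕ) => X / (2 * P1) < (n : ℝ) ∧ (n : ℝ) ≤ 4 * X / P1)
  set q := primorialBelow (X ^ ((2 : ℝ) / 11))
  have hpi := Real.pi_pos
  have hT0 : 0 < T := by linarith
  have hP0 : 0 < P1 := by linarith
  have hX4 : 4 ≤ X := by nlinarith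
  have hlog : 0 < Real.log X := Real.log_pos (by linarith)
  have hmem : ∀ n ∈ S, X / (2 * P1) < (n : ℝ) ∧ (n : ℝ) ≤ 4 * X / P1 := fun n hn =>
    (Finset.mem_filter.1 hn).2
  have hpos : ∀ n ∈ S, 0 < n := by
    intro n hn
    have : (0 : ℝ) < n := lt_trans (by positivity) (hmem n hn).1
    exact_mod_cast this
  have hterm : ∀ t : ℝ, ∑ n ∈ S, (ρm n : ℂ) * (n : ℂ) ^ (-(1 : ℂ) - Complex.I * (t : ℂ)) =
      ∑ n ∈ S, ((ρm n / n : ℝ) : ℂ) * Complex.exp ((t * -Real.log n : ℝ) * Complex.I) := by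
    intro t
    refine Finset.sum_congr rfl fun n hn => ?_
    have hn0 : (n : ℂ) ≠ 0 := by exact_mod_cast (hpos n hn).ne'
    rw [sub_eq_add_neg, Complex.cpow_add _ _ hn0, Complex.cpow_neg_one,
      Complex.cpow_def_of_ne_zero hn0, ← Complex.natCast_log]
    push_cast
    rw [div_eq_mul_inv, mul_assoc]
    congr 3
    ring
  simp only [hterm]
  have hmv := integral_norm_sq_expSum_le S (fun n => ((ρm n / n : ℝ) : ℂ))
    (fun n => -Real.log n) hT0
  have habs : ∀ m n : ℕ, |-Real.log (m : ℝ) - -Real.log (n : ℝ)| =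
      |Real.log (m : ℝ) - Real.log (n : ℝ)| := by
    intro m n
    rw [← abs_neg]
    congr 1
    ring
  simp only [Complex.norm_real, habs] at hmv
  have hnear := sum_near_diagonal_le S hpos hT0 (fun n hn => (hmem n hn).2) q
    (fun n => ‖ρm n / n‖) (fun n _ => norm_nonneg _) (fun n hn => by
      rw [Real.norm_eq_abs, abs_div, Nat.abs_cast]
      exact div_le_div_of_nonneg_right (hρ n hn) (Nat.cast_nonneg n))
  have hoff : ∑ k ∈ Finset.Icc 1 ⌊4 * X / P1 / T⌋₊, ∑ n ∈ S,
      (if Nat.Coprime (n * (n + k)) q then 1 else 0) / ((n : ℝ) * (n + k)) ≤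
      4 * c₂ / (T * Real.log X ^ 2) := by
    have hNT : 0 ≤ 4 * X / P1 / T := by positivity
    refine (Finset.sum_le_card_nsmul _ _ (c₂ * P1 / (X * Real.log X ^ 2)) fun k hk => ?_).trans ?_
    · rw [Finset.mem_Icc] at hk
      refine h2 k hk.1 ?_
      rw [← div_div]
      exact (Nat.le_floor_iff hNT).1 hk.2
    · rw [Nat.card_Icc, Nat.add_sub_cancel, nsmul_eq_mul]
      refine (mul_le_mul_of_nonneg_right (Nat.floor_le hNT) (by positivity)).trans_eq ?_
      field_simp
  refine hmv.trans ?_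
  have hsum := hnear.trans (add_le_add h1 (mul_le_mul_of_nonneg_left hoff zero_le_two))
  refine (mul_le_mul_of_nonneg_left hsum (by positivity)).trans ?_
  have hU : 0 ≤ T * P1 / (X * Real.log X) := by positivity
  have hV : 0 ≤ 1 / Real.log X ^ 2 := by positivity
  have e : 8 * Real.pi * T * (c₁ * P1 / (X * Real.log X) + 2 * (4 * c₂ / (T * Real.log X ^ 2))) =
      8 * Real.pi * (c₁ * (T * P1 / (X * Real.log X)) + 8 * c₂ * (1 / Real.log X ^ 2)) := by
    field_simp
    ring
  rw [e, mul_assoc (8 * Real.pi)]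
  refine mul_le_mul_of_nonneg_left ?_ (by positivity)
  nlinarith [mul_nonneg hc₁.le hV, mul_nonneg hc₂.le hU]
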